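/- Consistency of the sequential splitting with rational time discretization: Let X, X_m, P_m, J_m form an approximation scheme, let A, A_m and B, B_m each be stable and consistent approximating families of operators, and let r and q be rational functions with r(0) = r'(0) = 1, q(0) = q'(0) = 1, both bounded on the closed left half-plane ℂ₋, with r(hA_m) and q(hB_m) defined via their partial fraction decompositions as r(hA_m) := Σ_{i,j} C_{ij} [ (λ_i/h) R(λ_i/h, A_m) ]^{j} and similarly for q(hB_m). Then for every x ∈ D(A) ∩ D(B), ‖( J_m q(h B_m) r(h A_m) P_m x − J_m P_m x )/h − J_m (A_m + B_m) P_m x‖ → 0 as h → 0+, uniformly in m ∈ ℕ. -/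

import Mathlib

open Filter Topology

/-- `R` is the resolvent operator `R(lam, A) = (lam - A)⁻¹` of the (possibly
unbounded) linear operator `A`, given as a partially defined linear map. -/
structure IsResolvent {Y : Type*} [NormedAddCommGroup Y] [NormedSpace ℂ Y]
    (A : Y →ₗ.[ℂ] Y) (lam : ℂ) (R : Y →L[ℂ] Y) : Prop where
  mem : ∀ x : Y, R x ∈ A.domain
  eq_right : ∀ x : Y, lam • R x - A ⟨R x, mem x⟩ = x
  eq_left : ∀ y : A.domain, R (lam • (y : Y) - A y) = (y : Y)

/-- The operator `r(h A)` where the rational function `r` is given through its partial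
fraction decomposition `r(z) = Σ_{i,j} C i j • (1 - z/lam i)⁻ʲ` and the operator `A`
through its resolvent family `R`:  `r(h A) = Σ_{i,j} C i j • [(lam i/h) R(lam i/h, A)]ʲ`.
(For `h ≤ 0` it is defined to be the identity, corresponding to `r(0·A) = I`.) -/
noncomputable def ratOp {Y : Type*} [NormedAddCommGroup Y] [NormedSpace ℂ Y]
    (l : ℕ) (ν : Fin l → ℕ) (lam : Fin l → ℂ) (C : Fin l → ℕ → ℂ)
    (R : ℂ → Y →L[ℂ] Y) (h : ℝ) : Y →L[ℂ] Y :=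
  if h ≤ 0 then 1 else
    ∑ i, ∑ j ∈ Finset.Icc 1 (ν i), C i j • ((lam i / (h : ℂ)) • R (lam i / (h : ℂ))) ^ j

/-- The rational function `r(z) = Σ_{i,j} C i j (1 - z/lam i)⁻ʲ` given by a partial
fraction decomposition. -/
noncomputable def pfdFun (l : ℕ) (ν : Fin l → ℕ) (lam : Fin l → ℂ) (C : Fin l → ℕ → ℂ)
    (z : ℂ) : ℂ :=
  ∑ i, ∑ j ∈ Finset.Icc 1 (ν i), C i j * (1 - z / lam i) ^ (-(j : ℤ))

section Resolvent

variable {Y : Type*} [NormedAddCommGroup Y] [NormedSpace ℂ Y] {A : Y →ₗ.[ℂ] Y}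

lemma IsResolvent.smul_pow_apply_sub {μ : ℂ} {R : Y →L[ℂ] Y} (hR : IsResolvent A μ R)
    (hμ : μ ≠ 0) (y : A.domain) (j : ℕ) :
    ((μ • R) ^ j) (y : Y) - y = μ⁻¹ • ∑ k ∈ Finset.range j, ((μ • R) ^ (k + 1)) (A y) := by
  have hy : (μ • R) (y : Y) - y = μ⁻¹ • (μ • R) (A y) := by
    have h := hR.eq_left y
    rw [map_sub, map_smul] at h
    simp only [smul_apply]
    rw [inv_smul_smul₀ hμ, sub_eq_iff_eq_add]
    rw [sub_eq_iff_eq_add] at h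
    rw [h, add_comm]
  induction j with
  | zero => simp
  | succ j ih =>
    have h : ((μ • R) ^ (j + 1)) (y : Y) - y
        = ((μ • R) ^ j) ((μ • R) (y : Y) - y) + (((μ • R) ^ j) (y : Y) - y) := by
      rw [map_sub, pow_succ]
      simp only [mul_apply_eq_comp]
      abel
    rw [h, hy, ih, Finset.sum_range_succ, smul_add, map_smul, pow_succ (μ • R) j,
      mul_apply_eq_comp, add_comm]

lemma norm_smul_resolvent_pow_apply_le {R : ℂ → Y →L[ℂ] Y} {M : ℝ}
    (hR : ∀ lam : ℂ, 0 < lam.re → lam.re * ‖R lam‖ ≤ M) {lam : ℂ} (hlam : 0 < lam.re)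
    {h : ℝ} (hh : 0 < h) (k : ℕ) (y : Y) :
    ‖(((lam / (h : ℂ)) • R (lam / (h : ℂ))) ^ k) y‖ ≤ (‖lam‖ / lam.re * M) ^ k * ‖y‖ := by
  have hS : ‖(lam / (h : ℂ)) • R (lam / (h : ℂ))‖ ≤ ‖lam‖ / lam.re * M := by
    have hre : (lam / (h : ℂ)).re = lam.re / h := Complex.div_ofReal_re lam h
    have hb := hR (lam / (h : ℂ)) (by rw [hre]; positivity)
    rw [hre] at hb
    rw [norm_smul, norm_div, Complex.norm_real, Real.norm_of_nonneg hh.le]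
    calc ‖lam‖ / h * ‖R (lam / (h : ℂ))‖
        = ‖lam‖ / lam.re * (lam.re / h * ‖R (lam / (h : ℂ))‖) := by field_simp
      _ ≤ ‖lam‖ / lam.re * M := by gcongr
  have h0 : 0 ≤ ‖lam‖ / lam.re * M := (norm_nonneg _).trans hS
  induction k generalizing y with
  | zero => simp
  | succ k ih =>
    rw [pow_succ, pow_succ, mul_apply_eq_comp, mul_assoc]
    exact (ih _).trans (by gcongr; exact ContinuousLinearMap.le_of_opNorm_le _ hS y)

end Resolvent

section PartialFractions

variable {l : ℕ} {ν : Fin l → ℕ} {lam : Fin l → ℂ} {C : Fin l → ℕ → ℂ}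

lemma pfdFun_zero (l : ℕ) (ν : Fin l → ℕ) (lam : Fin l → ℂ) (C : Fin l → ℕ → ℂ) :
    pfdFun l ν lam C 0 = ∑ i, ∑ j ∈ Finset.Icc 1 (ν i), C i j := by
  simp [pfdFun]

lemma hasDerivAt_pfdFun_zero (l : ℕ) (ν : Fin l → ℕ) (lam : Fin l → ℂ) (C : Fin l → ℕ → ℂ) :
    HasDerivAt (pfdFun l ν lam C)
      (∑ i, ∑ j ∈ Finset.Icc 1 (ν i), C i j * (j * (lam i)⁻¹)) 0 := by
  unfold pfdFun
  refine HasDerivAt.fun_sum fun i _ => HasDerivAt.fun_sum fun j _ => ?_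
  refine HasDerivAt.const_mul _ ?_
  have h1 : HasDerivAt (fun z : ℂ => 1 - z / lam i) (-(lam i)⁻¹) 0 := by
    simpa using ((hasDerivAt_id (0 : ℂ)).div_const (lam i)).const_sub 1
  have h2 := (hasDerivAt_zpow (-(j : ℤ)) (1 - 0 / lam i) (by simp)).comp (0 : ℂ) h1
  simpa [Function.comp_def] using h2

variable {Y : Type*} [NormedAddCommGroup Y] [NormedSpace ℂ Y]

lemma ratOp_apply_sub (h0 : pfdFun l ν lam C 0 = 1) (R : ℂ → Y →L[ℂ] Y) {h : ℝ} (hh : 0 < h)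
    (y : Y) :
    ratOp l ν lam C R h y - y = ∑ i, ∑ j ∈ Finset.Icc 1 (ν i),
      C i j • ((((lam i / (h : ℂ)) • R (lam i / (h : ℂ))) ^ j) y - y) := by
  rw [pfdFun_zero] at h0
  simp only [smul_sub, Finset.sum_sub_distrib, ← Finset.sum_smul, h0, one_smul]
  simp [ratOp, not_le.2 hh]

lemma ratOp_diffQuot_sub {A : Y →ₗ.[ℂ] Y} {R : ℂ → Y →L[ℂ] Y}
    (hR : ∀ lam : ℂ, 0 < lam.re → IsResolvent A lam (R lam)) (hlam : ∀ i, 0 < (lam i).re)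
    (h0 : pfdFun l ν lam C 0 = 1) (h1 : HasDerivAt (pfdFun l ν lam C) 1 0)
    {h : ℝ} (hh : 0 < h) (y : A.domain) :
    (h : ℂ)⁻¹ • (ratOp l ν lam C R h y - y) - A y = ∑ i, ∑ j ∈ Finset.Icc 1 (ν i),
      (C i j * (lam i)⁻¹) • ∑ k ∈ Finset.range j,
        ((((lam i / (h : ℂ)) • R (lam i / (h : ℂ))) ^ (k + 1)) (A y) - A y) := by
  have hd := (hasDerivAt_pfdFun_zero l ν lam C).unique h1
  have hA : A y = ∑ i, ∑ j ∈ Finset.Icc 1 (ν i), (C i j * (lam i)⁻¹) • j • A y := by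
    simp only [← Nat.cast_smul_eq_nsmul ℂ, smul_smul, ← Finset.sum_smul]
    conv_lhs => rw [← one_smul ℂ (A y), ← hd]
    congr 1
    exact Finset.sum_congr rfl fun i _ => Finset.sum_congr rfl fun j _ => by ring
  have hhC : (h : ℂ) ≠ 0 := by exact_mod_cast hh.ne'
  have hs : (h : ℂ)⁻¹ • (ratOp l ν lam C R h y - y) = ∑ i, ∑ j ∈ Finset.Icc 1 (ν i),
      (C i j * (lam i)⁻¹) • ∑ k ∈ Finset.range j,
        (((lam i / (h : ℂ)) • R (lam i / (h : ℂ))) ^ (k + 1)) (A y) := by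
    rw [ratOp_apply_sub h0 R hh]
    simp only [Finset.smul_sum (s := Finset.univ)]
    refine Finset.sum_congr rfl fun i _ => ?_
    rw [Finset.smul_sum]
    refine Finset.sum_congr rfl fun j _ => ?_
    have hre : 0 < (lam i / (h : ℂ)).re := by
      rw [Complex.div_ofReal_re]; exact div_pos (hlam i) hh
    have hne : lam i / (h : ℂ) ≠ 0 := fun h' => by simp [h'] at hre
    rw [(hR _ hre).smul_pow_apply_sub hne, smul_smul, smul_smul]
    congr 1
    field_simp
  rw [hs]
  simp only [Finset.sum_sub_distrib, smul_sub, Finset.sum_const, Finset.card_range]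
  rw [← hA]

lemma exists_forall_norm_ratOp_apply_le (l : ℕ) (ν : Fin l → ℕ) {lam : Fin l → ℂ}
    (C : Fin l → ℕ → ℂ) (hlam : ∀ i, 0 < (lam i).re)
    {ι : Type*} {Y : ι → Type*} [∀ m, NormedAddCommGroup (Y m)] [∀ m, NormedSpace ℂ (Y m)]
    {R : ∀ m, ℂ → Y m →L[ℂ] Y m} {M : ℝ}
    (hR : ∀ m, ∀ lam : ℂ, 0 < lam.re → lam.re * ‖R m lam‖ ≤ M) :
    ∃ c, 0 ≤ c ∧ ∀ h : ℝ, 0 < h → ∀ m (y : Y m), ‖ratOp l ν lam C (R m) h y‖ ≤ c * ‖y‖ := by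
  refine ⟨∑ i, ∑ j ∈ Finset.Icc 1 (ν i), ‖C i j‖ * |(‖lam i‖ / (lam i).re * M) ^ j|,
    by positivity, fun h hh m y => ?_⟩
  simp only [ratOp, not_le.2 hh, if_false, sum_apply,
    smul_apply, Finset.sum_mul]
  refine norm_sum_le_of_le _ fun i _ => norm_sum_le_of_le _ fun j _ => ?_
  rw [norm_smul, mul_assoc]
  gcongr
  refine (norm_smul_resolvent_pow_apply_le (hR m) (hlam i) hh j y).trans ?_
  gcongr
  exact le_abs_self _

end PartialFractions

section Uniform

lemma eventually_forall_norm_resolvent_pow_sub_le {ι : Type*} {Y : ι → Type*}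
    [∀ m, NormedAddCommGroup (Y m)] [∀ m, NormedSpace ℂ (Y m)] {A : ∀ m, Y m →ₗ.[ℂ] Y m}
    {R : ∀ m, ℂ → Y m →L[ℂ] Y m} {M : ℝ}
    (hR : ∀ m, ∀ lam : ℂ, 0 < lam.re →
      IsResolvent (A m) lam (R m lam) ∧ lam.re * ‖R m lam‖ ≤ M)
    {w : ∀ m, Y m}
    (hw : ∀ ε > (0 : ℝ), ∃ (b : ℝ) (v : ∀ m, (A m).domain),
      (∀ m, ‖w m - v m‖ ≤ ε) ∧ ∀ m, ‖A m (v m)‖ ≤ b)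
    {lam : ℂ} (hlam : 0 < lam.re) (k : ℕ) {ε : ℝ} (hε : 0 < ε) :
    ∀ᶠ h : ℝ in 𝓝[>] 0, ∀ m,
      ‖(((lam / (h : ℂ)) • R m (lam / (h : ℂ))) ^ k) (w m) - w m‖ ≤ ε := by
  set c := ‖lam‖ / lam.re * M with hc
  set a := |c ^ k| + 1 with ha
  have ha0 : 0 < a := by positivity
  obtain ⟨b, v, hwv, hv⟩ := hw (ε / (2 * a)) (by positivity)
  set d := ‖lam‖⁻¹ * ∑ j ∈ Finset.range k, |c ^ (j + 1)| * |b| with hd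
  have hlim : Tendsto (fun h : ℝ => h * d) (𝓝[>] 0) (𝓝 0) := by
    have : Tendsto (fun h : ℝ => h * d) (𝓝 0) (𝓝 (0 * d)) := tendsto_id.mul_const d
    rw [zero_mul] at this
    exact this.mono_left nhdsWithin_le_nhds
  filter_upwards [hlim.eventually_le_const (half_pos hε), self_mem_nhdsWithin] with h hhd hh m
  have hh : 0 < h := hh
  have hre : 0 < (lam / (h : ℂ)).re := by
    rw [Complex.div_ofReal_re]; exact div_pos hlam hh
  have hne : lam / (h : ℂ) ≠ 0 := fun h' => by simp [h'] at hre
  have hpow := norm_smul_resolvent_pow_apply_le (fun μ hμ => (hR m μ hμ).2) hlam hh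
  set S := (lam / (h : ℂ)) • R m (lam / (h : ℂ)) with hS
  have h1 : ‖(S ^ k) (v m : Y m) - v m‖ ≤ h * d := by
    rw [hS, (hR m _ hre).1.smul_pow_apply_sub hne, ← hS, norm_smul, norm_inv, norm_div,
      Complex.norm_real, Real.norm_of_nonneg hh.le, hd, inv_div, ← mul_assoc, ← div_eq_mul_inv]
    gcongr
    refine norm_sum_le_of_le _ fun j _ => (hpow (j + 1) _).trans ?_
    gcongr
    · exact le_abs_self _
    · exact (hv m).trans (le_abs_self b)
  have h2 : ‖(S ^ k) (w m - v m)‖ ≤ |c ^ k| * (ε / (2 * a)) := by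
    refine (hpow k _).trans ?_
    gcongr
    · exact le_abs_self _
    · exact hwv m
  have h3 : |c ^ k| * (ε / (2 * a)) + ε / (2 * a) = ε / 2 := by
    rw [← add_one_mul, ← ha]; field_simp
  calc ‖(S ^ k) (w m) - w m‖
      = ‖(S ^ k) (w m - v m) - (w m - v m) + ((S ^ k) (v m : Y m) - v m)‖ := by
        rw [map_sub]; congr 1; abel
    _ ≤ ‖(S ^ k) (w m - v m)‖ + ‖w m - v m‖ + ‖(S ^ k) (v m : Y m) - v m‖ :=
        (norm_add_le _ _).trans (by gcongr; exact norm_sub_le _ _)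
    _ ≤ ε := by linarith [hwv m]

variable {X : Type*} [NormedAddCommGroup X] [NormedSpace ℂ X]
  {Xm : ℕ → Type*} [∀ m, NormedAddCommGroup (Xm m)] [∀ m, NormedSpace ℂ (Xm m)]
  {P : ∀ m, X →L[ℂ] Xm m} {J : ∀ m, Xm m →L[ℂ] X} {K : ℝ}
  {A : X →ₗ.[ℂ] X} {Am : ∀ m, Xm m →ₗ.[ℂ] Xm m}

lemma norm_le_of_leftInverse (hPJ : ∀ m (y : Xm m), P m (J m y) = y) (hP : ∀ m, ‖P m‖ ≤ K)
    (m : ℕ) (y : Xm m) : ‖y‖ ≤ K * ‖J m y‖ := by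
  conv_lhs => rw [← hPJ m y]
  exact (P m).le_of_opNorm_le (hP m) _

/-- A sequence that converges along the embeddings `J m` is approximated, uniformly in `m`, by
elements of the domains on which the operators are bounded uniformly in `m`. -/
lemma exists_domain_approx (hPJ : ∀ m (y : Xm m), P m (J m y) = y)
    (hJP : ∀ x : X, Tendsto (fun m => J m (P m x)) atTop (𝓝 x))
    (hK : 0 < K) (hP : ∀ m, ‖P m‖ ≤ K)
    (hAdense : Dense (A.domain : Set X)) (hAmdense : ∀ m, Dense ((Am m).domain : Set (Xm m)))
    (hPdom : ∀ m, ∀ x ∈ A.domain, P m x ∈ (Am m).domain)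
    (hcons : ∀ x : A.domain,
      Tendsto (fun m => J m ((Am m) ⟨P m (x : X), hPdom m x x.2⟩)) atTop (𝓝 (A x)))
    {y : ∀ m, Xm m} {z : X} (hy : Tendsto (fun m => J m (y m)) atTop (𝓝 z))
    {ε : ℝ} (hε : 0 < ε) :
    ∃ (b : ℝ) (v : ∀ m, (Am m).domain),
      (∀ m, ‖y m - v m‖ ≤ ε) ∧ ∀ m, ‖Am m (v m)‖ ≤ b := by
  obtain ⟨x, hx, hzx⟩ := hAdense.exists_dist_lt z (div_pos hε hK)
  have hclose : ∀ᶠ m in atTop, ‖y m - P m x‖ ≤ ε := by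
    have hlim : Tendsto (fun m => ‖J m (y m) - J m (P m x)‖) atTop (𝓝 ‖z - x‖) :=
      (hy.sub (hJP x)).norm
    rw [dist_eq_norm] at hzx
    filter_upwards [hlim.eventually_le_const hzx] with m hm
    refine (norm_le_of_leftInverse hPJ hP m _).trans ?_
    rw [map_sub]
    calc K * ‖J m (y m) - J m (P m x)‖ ≤ K * (ε / K) := by gcongr
      _ = ε := by field_simp
  have hex : ∀ m, ∃ v : (Am m).domain, ‖y m - v‖ ≤ ε ∧
      (‖y m - P m x‖ ≤ ε → v = ⟨P m x, hPdom m x hx⟩) := by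
    intro m
    by_cases hm : ‖y m - P m x‖ ≤ ε
    · exact ⟨⟨P m x, hPdom m x hx⟩, hm, fun _ => rfl⟩
    · obtain ⟨v, hv, hyv⟩ := (hAmdense m).exists_dist_lt (y m) hε
      exact ⟨⟨v, hv⟩, by rw [← dist_eq_norm]; exact hyv.le, fun h => absurd h hm⟩
  choose v hv hvP using hex
  have hbdd : ∀ᶠ m in atTop, ‖Am m (v m)‖ ≤ K * (‖A ⟨x, hx⟩‖ + 1) := by
    filter_upwards [hclose,
      (hcons ⟨x, hx⟩).norm.eventually_le_const (lt_add_one ‖A ⟨x, hx⟩‖)] with m hm hAx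
    rw [hvP m hm]
    exact (norm_le_of_leftInverse hPJ hP m _).trans (by gcongr)
  obtain ⟨b, hb⟩ := IsBoundedUnder.bddAbove_range (f := fun m => ‖Am m (v m)‖) ⟨_, hbdd⟩
  exact ⟨b, v, hv, fun m => hb ⟨m, rfl⟩⟩

lemma tendsto_resolvent_pow_sub
    (hPJ : ∀ m (y : Xm m), P m (J m y) = y)
    (hJP : ∀ x : X, Tendsto (fun m => J m (P m x)) atTop (𝓝 x))
    (hK : 0 < K) (hJ : ∀ m, ‖J m‖ ≤ K) (hP : ∀ m, ‖P m‖ ≤ K)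
    (hAdense : Dense (A.domain : Set X)) (hAmdense : ∀ m, Dense ((Am m).domain : Set (Xm m)))
    {R : ∀ m, ℂ → Xm m →L[ℂ] Xm m} {M : ℝ}
    (hR : ∀ m, ∀ lam : ℂ, 0 < lam.re →
      IsResolvent (Am m) lam (R m lam) ∧ lam.re * ‖R m lam‖ ≤ M)
    (hPdom : ∀ m, ∀ x ∈ A.domain, P m x ∈ (Am m).domain)
    (hcons : ∀ x : A.domain,
      Tendsto (fun m => J m ((Am m) ⟨P m (x : X), hPdom m x x.2⟩)) atTop (𝓝 (A x)))
    {y : ∀ m, Xm m} {z : X} (hy : Tendsto (fun m => J m (y m)) atTop (𝓝 z))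
    {lam : ℂ} (hlam : 0 < lam.re) (k : ℕ) :
    Tendsto (fun p : ℝ × ℕ => J p.2
        ((((lam / (p.1 : ℂ)) • R p.2 (lam / (p.1 : ℂ))) ^ k) (y p.2) - y p.2))
      (𝓝[>] 0 ×ˢ 𝓟 Set.univ) (𝓝 0) := by
  rw [Metric.tendsto_nhds]
  intro ε hε
  rw [eventually_prod_principal_iff]
  filter_upwards [eventually_forall_norm_resolvent_pow_sub_le hR
    (fun ε hε => exists_domain_approx hPJ hJP hK hP hAdense hAmdense hPdom hcons hy hε) hlam k
    (ε := ε / (2 * K)) (by positivity)] with h hh m _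
  rw [dist_zero_right]
  calc _ ≤ K * (ε / (2 * K)) := ((J m).le_of_opNorm_le (hJ m) _).trans (by gcongr; exact hh m)
    _ = ε / 2 := by field_simp
    _ < ε := half_lt_self hε

variable {l : ℕ} {ν : Fin l → ℕ} {lam : Fin l → ℂ} {C : Fin l → ℕ → ℂ}

lemma eventually_fst_pos : ∀ᶠ p : ℝ × ℕ in 𝓝[>] 0 ×ˢ 𝓟 Set.univ, 0 < p.1 :=
  tendsto_fst.eventually (self_mem_nhdsWithin (a := (0 : ℝ)) (s := Set.Ioi 0))

lemma tendsto_ratOp_sub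
    (hPJ : ∀ m (y : Xm m), P m (J m y) = y)
    (hJP : ∀ x : X, Tendsto (fun m => J m (P m x)) atTop (𝓝 x))
    (hK : 0 < K) (hJ : ∀ m, ‖J m‖ ≤ K) (hP : ∀ m, ‖P m‖ ≤ K)
    (hAdense : Dense (A.domain : Set X)) (hAmdense : ∀ m, Dense ((Am m).domain : Set (Xm m)))
    {R : ∀ m, ℂ → Xm m →L[ℂ] Xm m} {M : ℝ}
    (hR : ∀ m, ∀ lam : ℂ, 0 < lam.re →
      IsResolvent (Am m) lam (R m lam) ∧ lam.re * ‖R m lam‖ ≤ M)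
    (hPdom : ∀ m, ∀ x ∈ A.domain, P m x ∈ (Am m).domain)
    (hcons : ∀ x : A.domain,
      Tendsto (fun m => J m ((Am m) ⟨P m (x : X), hPdom m x x.2⟩)) atTop (𝓝 (A x)))
    (hlam : ∀ i, 0 < (lam i).re) (h0 : pfdFun l ν lam C 0 = 1)
    {y : ∀ m, Xm m} {z : X} (hy : Tendsto (fun m => J m (y m)) atTop (𝓝 z)) :
    Tendsto (fun p : ℝ × ℕ => J p.2 (ratOp l ν lam C (R p.2) p.1 (y p.2) - y p.2))
      (𝓝[>] 0 ×ˢ 𝓟 Set.univ) (𝓝 0) := by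
  have hsum := tendsto_finsetSum Finset.univ fun i _ =>
    tendsto_finsetSum (Finset.Icc 1 (ν i)) fun j _ =>
      (tendsto_resolvent_pow_sub hPJ hJP hK hJ hP hAdense hAmdense hR hPdom hcons hy
        (hlam i) j).const_smul (C i j)
  simp only [smul_zero, Finset.sum_const_zero] at hsum
  refine hsum.congr' ?_
  filter_upwards [eventually_fst_pos] with p hp
  simp only [ratOp_apply_sub h0 (R p.2) hp, map_sum, map_smul]

lemma tendsto_ratOp_diffQuot_sub
    (hPJ : ∀ m (y : Xm m), P m (J m y) = y)
    (hJP : ∀ x : X, Tendsto (fun m => J m (P m x)) atTop (𝓝 x))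
    (hK : 0 < K) (hJ : ∀ m, ‖J m‖ ≤ K) (hP : ∀ m, ‖P m‖ ≤ K)
    (hAdense : Dense (A.domain : Set X)) (hAmdense : ∀ m, Dense ((Am m).domain : Set (Xm m)))
    {R : ∀ m, ℂ → Xm m →L[ℂ] Xm m} {M : ℝ}
    (hR : ∀ m, ∀ lam : ℂ, 0 < lam.re →
      IsResolvent (Am m) lam (R m lam) ∧ lam.re * ‖R m lam‖ ≤ M)
    (hPdom : ∀ m, ∀ x ∈ A.domain, P m x ∈ (Am m).domain)
    (hcons : ∀ x : A.domain,
      Tendsto (fun m => J m ((Am m) ⟨P m (x : X), hPdom m x x.2⟩)) atTop (𝓝 (A x)))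
    (hlam : ∀ i, 0 < (lam i).re) (h0 : pfdFun l ν lam C 0 = 1)
    (h1 : HasDerivAt (pfdFun l ν lam C) 1 0) {x : X} (hx : x ∈ A.domain) :
    Tendsto (fun p : ℝ × ℕ => J p.2
        ((p.1 : ℂ)⁻¹ • (ratOp l ν lam C (R p.2) p.1 (P p.2 x) - P p.2 x)
          - Am p.2 ⟨P p.2 x, hPdom p.2 x hx⟩))
      (𝓝[>] 0 ×ˢ 𝓟 Set.univ) (𝓝 0) := by
  have hsum := tendsto_finsetSum Finset.univ fun i _ =>
    tendsto_finsetSum (Finset.Icc 1 (ν i)) fun j _ =>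
      (tendsto_finsetSum (Finset.range j) fun k _ =>
        tendsto_resolvent_pow_sub hPJ hJP hK hJ hP hAdense hAmdense hR hPdom hcons
          (hcons ⟨x, hx⟩) (hlam i) (k + 1)).const_smul (C i j * (lam i)⁻¹)
  simp only [smul_zero, Finset.sum_const_zero] at hsum
  refine hsum.congr' ?_
  filter_upwards [eventually_fst_pos] with p hp
  have h := ratOp_diffQuot_sub (fun μ hμ => (hR p.2 μ hμ).1) hlam h0 h1 hp
    ⟨P p.2 x, hPdom p.2 x hx⟩
  simp only [h, map_sum, map_smul]

end Uniform

/-- **Consistency of the sequential splitting with rational time discretization.**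
For every `x ∈ D(A) ∩ D(B)`,
`‖(J m q(h B m) r(h A m) P m x − J m P m x)/h − J m (A m + B m) P m x‖ → 0`
as `h → 0+`, uniformly in `m ∈ ℕ`. -/
theorem sequential_splitting_consistency
    (X : Type*) [NormedAddCommGroup X] [NormedSpace ℂ X] [CompleteSpace X]
    (Xm : ℕ → Type*) [∀ m, NormedAddCommGroup (Xm m)] [∀ m, NormedSpace ℂ (Xm m)]
    [∀ m, CompleteSpace (Xm m)]
    -- the approximation scheme
    (P : ∀ m, X →L[ℂ] Xm m) (J : ∀ m, Xm m →L[ℂ] X)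
    (hPJ : ∀ m (y : Xm m), P m (J m y) = y)
    (hJP : ∀ x : X, Tendsto (fun m => J m (P m x)) atTop (𝓝 x))
    (K : ℝ) (hK : 0 < K) (hJnorm : ∀ m, ‖J m‖ ≤ K) (hPnorm : ∀ m, ‖P m‖ ≤ K)
    -- the operators `A, A m`: closed and densely defined
    (A : X →ₗ.[ℂ] X) (hAclosed : IsClosed (A.graph : Set (X × X)))
    (hAdense : Dense (A.domain : Set X))
    (Am : ∀ m, Xm m →ₗ.[ℂ] Xm m)
    (hAmclosed : ∀ m, IsClosed ((Am m).graph : Set (Xm m × Xm m)))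
    (hAmdense : ∀ m, Dense ((Am m).domain : Set (Xm m)))
    -- stability of the family `A, A m`
    (RA : ℂ → X →L[ℂ] X) (RAm : ∀ m, ℂ → Xm m →L[ℂ] Xm m) (MA : ℝ) (hMA : 0 ≤ MA)
    (hRA : ∀ lam : ℂ, 0 < lam.re → IsResolvent A lam (RA lam) ∧ lam.re * ‖RA lam‖ ≤ MA)
    (hRAm : ∀ m, ∀ lam : ℂ, 0 < lam.re →
      IsResolvent (Am m) lam (RAm m lam) ∧ lam.re * ‖RAm m lam‖ ≤ MA)
    -- consistency of the family `A, A m`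
    (hPdomA : ∀ m, ∀ x ∈ A.domain, P m x ∈ (Am m).domain)
    (hconsA : ∀ x : A.domain,
      Tendsto (fun m => J m ((Am m) ⟨P m (x : X), hPdomA m x x.2⟩)) atTop (𝓝 (A x)))
    -- the operators `B, B m`: closed and densely defined
    (B : X →ₗ.[ℂ] X) (hBclosed : IsClosed (B.graph : Set (X × X)))
    (hBdense : Dense (B.domain : Set X))
    (Bm : ∀ m, Xm m →ₗ.[ℂ] Xm m)
    (hBmclosed : ∀ m, IsClosed ((Bm m).graph : Set (Xm m × Xm m)))
    (hBmdense : ∀ m, Dense ((Bm m).domain : Set (Xm m)))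
    -- stability of the family `B, B m`
    (RB : ℂ → X →L[ℂ] X) (RBm : ∀ m, ℂ → Xm m →L[ℂ] Xm m) (MB : ℝ) (hMB : 0 ≤ MB)
    (hRB : ∀ lam : ℂ, 0 < lam.re → IsResolvent B lam (RB lam) ∧ lam.re * ‖RB lam‖ ≤ MB)
    (hRBm : ∀ m, ∀ lam : ℂ, 0 < lam.re →
      IsResolvent (Bm m) lam (RBm m lam) ∧ lam.re * ‖RBm m lam‖ ≤ MB)
    -- consistency of the family `B, B m`
    (hPdomB : ∀ m, ∀ x ∈ B.domain, P m x ∈ (Bm m).domain)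
    (hconsB : ∀ x : B.domain,
      Tendsto (fun m => J m ((Bm m) ⟨P m (x : X), hPdomB m x x.2⟩)) atTop (𝓝 (B x)))
    -- the rational function `r`, via its partial fraction decomposition
    (lr : ℕ) (νr : Fin lr → ℕ) (hνr : ∀ i, 1 ≤ νr i) (lamr : Fin lr → ℂ)
    (Cr : Fin lr → ℕ → ℂ) (hlamr : ∀ i, 0 < (lamr i).re)
    (hr0 : pfdFun lr νr lamr Cr 0 = 1)
    (hr1 : HasDerivAt (pfdFun lr νr lamr Cr) 1 0)
    (hrbdd : ∃ Cb : ℝ, ∀ z : ℂ, z.re ≤ 0 → ‖pfdFun lr νr lamr Cr z‖ ≤ Cb)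
    -- the rational function `q`, via its partial fraction decomposition
    (lq : ℕ) (νq : Fin lq → ℕ) (hνq : ∀ i, 1 ≤ νq i) (lamq : Fin lq → ℂ)
    (Cq : Fin lq → ℕ → ℂ) (hlamq : ∀ i, 0 < (lamq i).re)
    (hq0 : pfdFun lq νq lamq Cq 0 = 1)
    (hq1 : HasDerivAt (pfdFun lq νq lamq Cq) 1 0)
    (hqbdd : ∃ Cb : ℝ, ∀ z : ℂ, z.re ≤ 0 → ‖pfdFun lq νq lamq Cq z‖ ≤ Cb)
 :
    ∀ x : X, ∀ hxA : x ∈ A.domain, ∀ hxB : x ∈ B.domain, ∀ ε > (0 : ℝ), ∃ δ > (0 : ℝ),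
      ∀ h : ℝ, 0 < h → h < δ → ∀ m : ℕ,
        ‖((h : ℂ))⁻¹ •
            (J m (ratOp lq νq lamq Cq (RBm m) h (ratOp lr νr lamr Cr (RAm m) h (P m x)))
              - J m (P m x))
          - J m ((Am m) ⟨P m x, hPdomA m x hxA⟩ + (Bm m) ⟨P m x, hPdomB m x hxB⟩)‖ ≤ ε := by
  intro x hxA hxB ε hε
  have hA := tendsto_ratOp_diffQuot_sub hPJ hJP hK hJnorm hPnorm hAdense hAmdense hRAm hPdomA
    hconsA hlamr hr0 hr1 hxA
  have hB := tendsto_ratOp_diffQuot_sub hPJ hJP hK hJnorm hPnorm hBdense hBmdense hRBm hPdomB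
    hconsB hlamq hq0 hq1 hxB
  have hBA := tendsto_ratOp_sub hPJ hJP hK hJnorm hPnorm hBdense hBmdense hRBm hPdomB
    hconsB hlamq hq0 (hconsA ⟨x, hxA⟩)
  obtain ⟨c, hc, hq⟩ := exists_forall_norm_ratOp_apply_le lq νq Cq hlamq
    (fun m μ hμ => (hRBm m μ hμ).2)
  have hlim := ((hA.norm.const_mul (K * (c * K))).add hBA.norm).add hB.norm
  simp only [norm_zero, mul_zero, add_zero] at hlim
  have hev := hlim.eventually_le_const hε
  rw [eventually_prod_principal_iff] at hev
  obtain ⟨δ, hδ, hsub⟩ := mem_nhdsGT_iff_exists_Ioo_subset.1 hev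
  refine ⟨δ, hδ, fun h hh hhδ m => ?_⟩
  refine le_trans ?_ (hsub ⟨hh, hhδ⟩ m (Set.mem_univ m))
  dsimp only
  set Q := ratOp lq νq lamq Cq (RBm m) h
  set T := ratOp lr νr lamr Cr (RAm m) h
  set a := Am m ⟨P m x, hPdomA m x hxA⟩
  set b := Bm m ⟨P m x, hPdomB m x hxB⟩
  have hQ : ∀ v, ‖J m (Q v)‖ ≤ K * (c * K) * ‖J m v‖ := fun v =>
    calc ‖J m (Q v)‖ ≤ K * ‖Q v‖ := (J m).le_of_opNorm_le (hJnorm m) _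
      _ ≤ K * (c * (K * ‖J m v‖)) := by
        gcongr
        refine (hq h hh m v).trans ?_
        gcongr
        exact norm_le_of_leftInverse hPJ hPnorm m v
      _ = K * (c * K) * ‖J m v‖ := by ring
  have hsplit : (h : ℂ)⁻¹ • (J m (Q (T (P m x))) - J m (P m x)) - J m (a + b)
      = J m (Q ((h : ℂ)⁻¹ • (T (P m x) - P m x) - a)) + J m (Q a - a)
        + J m ((h : ℂ)⁻¹ • (Q (P m x) - P m x) - b) := by
    simp only [map_sub, map_add, map_smul, smul_sub]
    abel
  rw [hsplit]
  exact (norm_add₃_le).trans (by gcongr; exact hQ _)
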